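/- arXiv:2301.05758 — 4 statements merged into one kernel-verified Lean document; each statement's English description precedes it below -/
import Mathlib

section
/- Let P be the Pell sequence (P_0 = 0, P_1 = 1, P_n = 2P_{n-1} + P_{n-2}) and Q the associated Pell sequence (Q_0 = 1, Q_1 = 1, Q_n = 2Q_{n-1} + Q_{n-2}). For all integers s, r ≥ 1 with s even: if s ≡ 0 (mod 4) then P_{s+r} − P_r = 2·P_{s/2}·Q_{s/2+r}, and if s ≡ 2 (mod 4) then P_{s+r} − P_r = 2·Q_{s/2}·P_{s/2+r}. -/
/-- The Pell sequence: P₀ = 0, P₁ = 1, Pₙ = 2Pₙ₋₁ + Pₙ₋₂. -/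
def pell : ℕ → ℤ
  | 0 => 0
  | 1 => 1
  | n + 2 => 2 * pell (n + 1) + pell n

/-- The associated Pell sequence: Q₀ = 1, Q₁ = 1, Qₙ = 2Qₙ₋₁ + Qₙ₋₂. -/
def assocPell : ℕ → ℤ
  | 0 => 1
  | 1 => 1
  | n + 2 => 2 * assocPell (n + 1) + assocPell n

theorem pell_succ_and_assocPell_succ (n : ℕ) :
    pell (n + 1) = pell n + assocPell n ∧ assocPell (n + 1) = 2 * pell n + assocPell n := by
  induction n with
  | zero => simp [pell, assocPell]
  | succ n ih =>
    rw [pell, assocPell]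
    constructor <;> linarith [ih.1, ih.2]

theorem pell_succ (n : ℕ) : pell (n + 1) = pell n + assocPell n :=
  (pell_succ_and_assocPell_succ n).1

theorem assocPell_succ (n : ℕ) : assocPell (n + 1) = 2 * pell n + assocPell n :=
  (pell_succ_and_assocPell_succ n).2

theorem pell_add_and_assocPell_add (m n : ℕ) :
    pell (m + n) = pell m * assocPell n + assocPell m * pell n ∧
    assocPell (m + n) = assocPell m * assocPell n + 2 * pell m * pell n := by
  induction n with
  | zero => simp [pell, assocPell]
  | succ n ih =>
    rw [← add_assoc, pell_succ (m + n), assocPell_succ (m + n), pell_succ n, assocPell_succ n,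
      ih.1, ih.2]
    constructor <;> ring

theorem pell_add (m n : ℕ) : pell (m + n) = pell m * assocPell n + assocPell m * pell n :=
  (pell_add_and_assocPell_add m n).1

theorem assocPell_add (m n : ℕ) :
    assocPell (m + n) = assocPell m * assocPell n + 2 * pell m * pell n :=
  (pell_add_and_assocPell_add m n).2

theorem assocPell_sq_sub_two_mul_pell_sq (n : ℕ) :
    assocPell n ^ 2 - 2 * pell n ^ 2 = (-1) ^ n := by
  induction n with
  | zero => simp [pell, assocPell]
  | succ n ih =>
    rw [pell_succ, assocPell_succ, pow_succ (-1), ← ih]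
    ring

/-- The analogue for Pell numbers of d'Ocagne's identity. -/
theorem assocPell_mul_pell_add_sub (m r : ℕ) :
    assocPell m * pell (m + r) - pell m * assocPell (m + r) = (-1) ^ m * pell r := by
  rw [pell_add, assocPell_add, ← assocPell_sq_sub_two_mul_pell_sq]
  ring

theorem pell_sub_pell (s r : ℕ) (hs : 1 ≤ s) (hr : 1 ≤ r) (hse : s % 2 = 0) :
    (s % 4 = 0 → pell (s + r) - pell r = 2 * pell (s / 2) * assocPell (s / 2 + r)) ∧
    (s % 4 = 2 → pell (s + r) - pell r = 2 * assocPell (s / 2) * pell (s / 2 + r)) := by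
  obtain ⟨m, rfl⟩ : ∃ m, s = 2 * m := ⟨s / 2, by omega⟩
  have hm : 2 * m / 2 = m := by omega
  have hadd : pell (2 * m + r) = pell m * assocPell (m + r) + assocPell m * pell (m + r) := by
    rw [two_mul, add_assoc, pell_add]
  have hsub := assocPell_mul_pell_add_sub m r
  rw [hm]
  constructor
  · intro h
    have hpow : (-1 : ℤ) ^ m = 1 := Even.neg_one_pow (Nat.even_iff.mpr (by omega))
    rw [hpow] at hsub
    linarith
  · intro h
    have hpow : (-1 : ℤ) ^ m = -1 := Odd.neg_one_pow (Nat.odd_iff.mpr (by omega))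
    rw [hpow] at hsub
    linarith
end

section
/- Let P be the Pell sequence (P_0 = 0, P_1 = 1, P_n = 2P_{n-1} + P_{n-2}), Q the associated Pell sequence (Q_0 = 1, Q_1 = 1, Q_n = 2Q_{n-1} + Q_{n-2}), and B the balancing sequence (B_0 = 0, B_1 = 1, B_n = 6B_{n-1} − B_{n-2}). For every k ≥ 1, the greatest common divisor of the set { Σ_{i=1}^{k} B_{n+i} : n ≥ 0 } of all sums of k consecutive balancing numbers equals P_k/2 if k is even, and equals Q_k if k is odd. -/
/-- The balancing sequence: B₀ = 0, B₁ = 1, Bₙ = 6Bₙ₋₁ − Bₙ₋₂. -/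
def balancing : ℕ → ℤ
  | 0 => 0
  | 1 => 1
  | n + 2 => 6 * balancing (n + 1) - balancing n

/-- `d` is the greatest common divisor of the set `{S n : n ≥ 0}`: `d ≥ 1`, `d` divides
every element of the set, and every common divisor of the set divides `d`. -/
def IsSetGCD (S : ℕ → ℤ) (d : ℤ) : Prop :=
  1 ≤ d ∧ (∀ n : ℕ, d ∣ S n) ∧ ∀ e : ℤ, (∀ n : ℕ, e ∣ S n) → e ∣ d

theorem balancing_add (m n : ℕ) :
    balancing (m + n + 1) =
      balancing (m + 1) * balancing (n + 1) - balancing m * balancing n := by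
  induction m using Nat.twoStepInduction with
  | zero => simp [balancing]
  | one =>
    rw [show 1 + n + 1 = n + 2 by ring]
    simp [balancing]
  | more m ih₀ ih₁ =>
    rw [show m + 2 + n + 1 = m + n + 1 + 2 by ring, balancing,
      show m + n + 1 + 1 = m + 1 + n + 1 by ring, ih₀, ih₁]
    simp only [balancing]
    ring

theorem pell_two_mul (n : ℕ) : pell (2 * n) = 2 * balancing n := by
  induction n using Nat.twoStepInduction with
  | zero => rfl
  | one => rfl
  | more n ih₀ ih₁ =>
    rw [show 2 * (n + 1) = 2 * n + 2 by ring] at ih₁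
    rw [show 2 * (n + 2) = 2 * n + 4 by ring]
    simp only [pell, balancing] at *
    linarith

theorem assocPell_two_mul_add_one (n : ℕ) :
    assocPell (2 * n + 1) = balancing (n + 1) + balancing n := by
  induction n using Nat.twoStepInduction with
  | zero => rfl
  | one => rfl
  | more n ih₀ ih₁ =>
    rw [show 2 * (n + 1) + 1 = 2 * n + 3 by ring] at ih₁
    rw [show 2 * (n + 2) + 1 = 2 * n + 5 by ring]
    simp only [assocPell, balancing] at *
    linarith

theorem balancing_nonneg_and_lt_succ (n : ℕ) :
    0 ≤ balancing n ∧ balancing n < balancing (n + 1) := by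
  induction n with
  | zero => simp [balancing]
  | succ n ih =>
    simp only [balancing]
    omega

theorem one_le_balancing_succ (n : ℕ) : 1 ≤ balancing (n + 1) := by
  have := balancing_nonneg_and_lt_succ n
  omega

theorem one_le_assocPell_two_mul_add_one (n : ℕ) : 1 ≤ assocPell (2 * n + 1) := by
  have := balancing_nonneg_and_lt_succ n
  rw [assocPell_two_mul_add_one]
  omega

theorem isCoprime_balancing_succ (n : ℕ) : IsCoprime (balancing n) (balancing (n + 1)) := by
  induction n with
  | zero => exact isCoprime_one_right
  | succ n ih =>
    obtain ⟨a, b, h⟩ := ih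
    exact ⟨b + 6 * a, -a, by simp only [balancing]; linarith⟩

theorem isCoprime_assocPell_odd (n : ℕ) :
    IsCoprime (assocPell (2 * n + 1)) (assocPell (2 * (n + 1) + 1)) := by
  induction n with
  | zero => exact isCoprime_one_left
  | succ n ih =>
    obtain ⟨a, b, h⟩ := ih
    refine ⟨b + 6 * a, -a, ?_⟩
    simp only [assocPell_two_mul_add_one, balancing] at h ⊢
    linarith

theorem sum_balancing (n j : ℕ) :
    ∑ i ∈ Finset.Icc 1 (2 * j), balancing (n + i) =
        balancing j * assocPell (2 * (n + j) + 1) ∧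
      ∑ i ∈ Finset.Icc 1 (2 * j + 1), balancing (n + i) =
        assocPell (2 * j + 1) * balancing (n + j + 1) := by
  have odd_of_even (j : ℕ) (h : ∑ i ∈ Finset.Icc 1 (2 * j), balancing (n + i) =
      balancing j * assocPell (2 * (n + j) + 1)) :
      ∑ i ∈ Finset.Icc 1 (2 * j + 1), balancing (n + i) =
        assocPell (2 * j + 1) * balancing (n + j + 1) := by
    rw [Finset.sum_Icc_succ_top (by omega), h,
      show n + (2 * j + 1) = j + (n + j) + 1 by ring, balancing_add]
    simp only [assocPell_two_mul_add_one]
    ring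
  induction j with
  | zero => exact ⟨by simp [balancing], odd_of_even 0 (by simp [balancing])⟩
  | succ j ih =>
    suffices h : _ from ⟨h, odd_of_even (j + 1) h⟩
    rw [show 2 * (j + 1) = 2 * j + 1 + 1 by ring, Finset.sum_Icc_succ_top (by omega), ih.2,
      show n + (2 * j + 1 + 1) = j + (n + j + 1) + 1 by ring, balancing_add j (n + j + 1),
      show 2 * (n + (j + 1)) + 1 = 2 * (n + j + 1) + 1 by ring]
    simp only [assocPell_two_mul_add_one]
    ring

theorem isSetGCD_of_eq_mul {S f : ℕ → ℤ} {d : ℤ} (hd : 1 ≤ d) (hS : ∀ n, S n = d * f n)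
    (hf : IsCoprime (f 0) (f 1)) : IsSetGCD S d := by
  refine ⟨hd, fun n => ⟨f n, hS n⟩, fun e he => ?_⟩
  obtain ⟨a, b, h⟩ := hf
  have hd' : d = a * S 0 + b * S 1 := by
    rw [hS, hS]
    linear_combination -d * h
  rw [hd']
  exact dvd_add ((he 0).mul_left a) ((he 1).mul_left b)

theorem gcd_sums_balancing (k : ℕ) (hk : 1 ≤ k) :
    (Even k →
      IsSetGCD (fun n => ∑ i ∈ Finset.Icc 1 k, balancing (n + i)) (pell k / 2)) ∧
    (Odd k →
      IsSetGCD (fun n => ∑ i ∈ Finset.Icc 1 k, balancing (n + i)) (assocPell k)) := by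
  refine ⟨fun h => ?_, fun h => ?_⟩
  · obtain ⟨j, rfl⟩ := h.exists_two_nsmul
    obtain ⟨j, rfl⟩ : ∃ i, j = i + 1 := ⟨j - 1, by simp at hk; omega⟩
    rw [smul_eq_mul, pell_two_mul, Int.mul_ediv_cancel_left _ two_ne_zero]
    refine isSetGCD_of_eq_mul (one_le_balancing_succ j) (fun n => (sum_balancing n _).1) ?_
    simpa only [zero_add, add_comm 1] using isCoprime_assocPell_odd (j + 1)
  · obtain ⟨j, rfl⟩ := h
    refine isSetGCD_of_eq_mul (one_le_assocPell_two_mul_add_one j)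
      (fun n => (sum_balancing n _).2) ?_
    simpa only [zero_add, add_comm 1] using isCoprime_balancing_succ (j + 1)
end

section
/- Let B be the balancing sequence (B_0 = 0, B_1 = 1, B_n = 6B_{n-1} − B_{n-2}) and b the cobalancing sequence (b_0 = 0, b_1 = 0, b_n = 6b_{n-1} − b_{n-2} + 2). Define σ_b(k,n) = Σ_{i=1}^{k} b_{n+i}. For all k ≥ 1 and all n ≥ 0: 2·σ_b(k,n) = B_{k+n} − B_n − k. -/
/-- The cobalancing sequence: b₀ = 0, b₁ = 0, bₙ = 6bₙ₋₁ − bₙ₋₂ + 2. -/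
def cobalancing : ℕ → ℤ
  | 0 => 0
  | 1 => 0
  | n + 2 => 6 * cobalancing (n + 1) - cobalancing n + 2

theorem two_mul_cobalancing_succ (m : ℕ) :
    2 * cobalancing (m + 1) = balancing (m + 1) - balancing m - 1 := by
  induction m using Nat.twoStepInduction with
  | zero => simp [cobalancing, balancing]
  | one => simp [cobalancing, balancing]
  | more m ih₀ ih₁ =>
    have hb : cobalancing (m + 2 + 1) = 6 * cobalancing (m + 1 + 1) - cobalancing (m + 1) + 2 := rfl
    have hB : balancing (m + 2 + 1) = 6 * balancing (m + 1 + 1) - balancing (m + 1) := rfl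
    have hB' : balancing (m + 2) = 6 * balancing (m + 1) - balancing m := rfl
    linarith

theorem sigma_cobalancing (k n : ℕ) (hk : 1 ≤ k) :
    2 * (∑ i ∈ Finset.Icc 1 k, cobalancing (n + i)) = balancing (k + n) - balancing n - k := by
  clear hk
  induction k with
  | zero => simp
  | succ k ih =>
    rw [Finset.sum_Icc_succ_top (by omega), mul_add, ih, ← add_assoc,
      two_mul_cobalancing_succ, Nat.add_comm n k, Nat.add_right_comm k 1 n]
    push_cast
    ring
end

section
/- Let P be the Pell sequence (P_0 = 0, P_1 = 1, P_n = 2P_{n-1} + P_{n-2}) and Q the associated Pell sequence (Q_0 = 1, Q_1 = 1, Q_n = 2Q_{n-1} + Q_{n-2}). For all k ≥ 2, the integer P_k·Q_k − k is divisible by 4, i.e., ν_2(P_k·Q_k − k) ≥ 2. -/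
theorem pell_assocPell_emod_four (j : ℕ) :
    pell (4 * j) % 4 = 0 ∧ pell (4 * j + 1) % 4 = 1 ∧
      assocPell (4 * j) % 4 = 1 ∧ assocPell (4 * j + 1) % 4 = 1 := by
  induction j with
  | zero => simp [pell, assocPell]
  | succ j ih =>
    simp only [Nat.mul_succ, pell, assocPell]
    omega

theorem four_dvd_pell_mul_assocPell_sub (k : ℕ) (hk : 2 ≤ k) :
    (4 : ℤ) ∣ pell k * assocPell k - k := by
  obtain ⟨hP₀, hP₁, hQ₀, hQ₁⟩ := pell_assocPell_emod_four (k / 4)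
  have hP₂ : pell (4 * (k / 4) + 2) % 4 = 2 := by simp only [pell]; omega
  have hP₃ : pell (4 * (k / 4) + 3) % 4 = 1 := by simp only [pell]; omega
  have hQ₂ : assocPell (4 * (k / 4) + 2) % 4 = 3 := by simp only [assocPell]; omega
  have hQ₃ : assocPell (4 * (k / 4) + 3) % 4 = 3 := by simp only [assocPell]; omega
  have h_cases : k = 4 * (k / 4) ∨ k = 4 * (k / 4) + 1 ∨ k = 4 * (k / 4) + 2 ∨
      k = 4 * (k / 4) + 3 := by omega
  apply Int.dvd_of_emod_eq_zero
  rw [Int.sub_emod, Int.mul_emod]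
  generalize k / 4 = j at *
  rcases h_cases with rfl | rfl | rfl | rfl <;> simp only [*] <;> omega
end
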